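/- Let Λ = (λ_k)_{k≥1} be a strictly increasing sequence of positive reals with ∑_k 1/λ_k < ∞, and let φ : [0,1] → [0,1] be Borel measurable with φ(x₀) = 1 for some x₀ ∈ [0,1]. If C_φ : M²_Λ → L²([0,1]) is compact, i.e. there exists C > 0 with ‖g∘φ‖_{L²} ≤ C‖g‖_{L²} for every g in the linear span of the monomials x ↦ x^{λ_k}, and every sequence (g_n) in this span with ‖g_n‖_{L²} ≤ 1 admits a subsequence such that (g_{n_j}∘φ) is Cauchy in L²([0,1]), then: if x₀ > 0 then limsup_{t→x₀⁻} (1 − φ(t))/(x₀ − t) = +∞, and if x₀ < 1 then limsup_{t→x₀⁺} (1 − φ(t))/(t − x₀) = +∞. -/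

import Mathlib

open MeasureTheory Filter

/-- Lebesgue measure restricted to the unit interval `[0,1]`. -/
noncomputable def m01 : Measure ℝ := volume.restrict (Set.Icc (0 : ℝ) 1)

/-- `g` belongs to the linear span of the monomials `x ↦ x^{Λ k}`. -/
def inSpan (Λ : ℕ → ℝ) (g : ℝ → ℝ) : Prop :=
  ∃ (n : ℕ) (c : Fin n → ℝ) (k : Fin n → ℕ),
    ∀ x : ℝ, g x = ∑ i, c i * x ^ (Λ (k i))

lemma aux_cheb (f : ℝ → ℝ) (μ : Measure ℝ) (hf : AEStronglyMeasurable f μ) (a : ℝ) (ha : 0 ≤ a)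
    (S : Set ℝ) (hS : ∀ x ∈ S, a ≤ f x) :
    ENNReal.ofReal a ^ 2 * μ S ≤ eLpNorm f 2 μ ^ 2 := by
  have h := mul_meas_ge_le_pow_eLpNorm' (μ := μ) (p := 2) two_ne_zero ENNReal.ofNat_ne_top hf
    (ENNReal.ofReal a)
  simp only [ENNReal.toReal_ofNat, ENNReal.rpow_ofNat] at h
  refine le_trans ?_ h
  gcongr
  intro x hx
  have := hS x hx
  simp only [Set.mem_setOf_eq]
  rw [← ofReal_norm_eq_enorm]
  apply ENNReal.ofReal_le_ofReal
  exact this.trans (le_abs_self _)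

lemma aux_norm (l : ℝ) (hl : 0 < l) :
    eLpNorm (fun x : ℝ => √(2 * l + 1) * x ^ l) 2 m01 ≤ 1 := by
  rw [eLpNorm_eq_lintegral_rpow_enorm_toReal two_ne_zero ENNReal.ofNat_ne_top]
  simp only [ENNReal.toReal_ofNat, ENNReal.rpow_ofNat]
  apply ENNReal.rpow_le_one _ (by norm_num)
  have h1 : ∫⁻ x, ‖√(2 * l + 1) * x ^ l‖ₑ ^ 2 ∂m01
      = ∫⁻ x in Set.Icc (0:ℝ) 1, ENNReal.ofReal ((2 * l + 1) * x ^ (2 * l)) := by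
    unfold m01
    apply setLIntegral_congr_fun measurableSet_Icc
    intro x hx
    simp only
    rw [← ofReal_norm_eq_enorm, ← ENNReal.ofReal_pow (norm_nonneg _)]
    congr 1
    rw [Real.norm_eq_abs, sq_abs, mul_pow, Real.sq_sqrt (by linarith), mul_comm 2 l,
      Real.rpow_mul hx.1]
    norm_num
  have hi : IntervalIntegrable (fun x : ℝ => (2 * l + 1) * x ^ (2 * l)) volume 0 1 :=
    (intervalIntegral.intervalIntegrable_rpow' (by linarith)).const_mul _
  rw [h1, ← ofReal_integral_eq_lintegral_ofReal]
  · rw [integral_Icc_eq_integral_Ioc, ← intervalIntegral.integral_of_le zero_le_one,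
      intervalIntegral.integral_const_mul, integral_rpow (Or.inl (by linarith))]
    rw [Real.one_rpow, Real.zero_rpow (by linarith), sub_zero, mul_one_div_cancel (by linarith)]
    simp
  · exact (intervalIntegrable_iff_integrableOn_Icc_of_le zero_le_one).1 hi
  · filter_upwards [ae_restrict_mem measurableSet_Icc] with x hx
    have := Real.rpow_nonneg hx.1 (2 * l)
    simp only [Pi.zero_apply]
    positivity

lemma aux_lim (y : ℝ) (h0 : 0 ≤ y) (h1 : y < 1) :
    Tendsto (fun l : ℝ => √(2 * l + 1) * y ^ l) atTop (nhds 0) := by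
  rcases h0.eq_or_lt with rfl | h0
  · apply tendsto_const_nhds.congr'
    filter_upwards [eventually_gt_atTop 0] with l hl
    rw [Real.zero_rpow hl.ne', mul_zero]
  have hb : 0 < -Real.log y := by
    have := Real.log_neg h0 h1
    linarith
  have h := (tendsto_rpow_mul_exp_neg_mul_atTop_nhds_zero 1 _ hb).const_mul 3
  rw [mul_zero] at h
  refine squeeze_zero' (Eventually.of_forall fun l => by positivity) ?_ h
  filter_upwards [eventually_ge_atTop 1] with l hl
  rw [Real.rpow_one, Real.rpow_def_of_pos h0, neg_neg, ← mul_assoc]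
  gcongr
  apply Real.sqrt_le_iff.2
  constructor <;> nlinarith

lemma aux_key
    (Λ : ℕ → ℝ) (hpos : ∀ k, 0 < Λ k)
    (hsum : Summable fun k => 1 / Λ k)
    (φ : ℝ → ℝ) (hmeas : Measurable φ)
    (hmaps : Set.MapsTo φ (Set.Icc (0 : ℝ) 1) (Set.Icc (0 : ℝ) 1))
    (C : ℝ)
    (hbd : ∀ g : ℝ → ℝ, inSpan Λ g →
      eLpNorm (fun x => g (φ x)) 2 m01 ≤ ENNReal.ofReal C * eLpNorm g 2 m01)
    (hcpt : ∀ g : ℕ → ℝ → ℝ, (∀ n, inSpan Λ (g n)) →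
      (∀ n, eLpNorm (g n) 2 m01 ≤ 1) →
      ∃ σ : ℕ → ℕ, StrictMono σ ∧
        ∀ ε : ℝ, 0 < ε → ∃ N : ℕ, ∀ j ≥ N, ∀ j' ≥ N,
          eLpNorm (fun x => g (σ j) (φ x) - g (σ j') (φ x)) 2 m01 ≤
            ENNReal.ofReal ε)
    (M δ : ℝ) (hM : 0 < M) (hδ : 0 < δ) (S : ℝ → Set ℝ)
    (hSsub : ∀ r, 0 < r → r < δ → S r ⊆ Set.Icc 0 1)
    (hSv : ∀ r, 0 < r → r < δ → volume (S r) = ENNReal.ofReal r)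
    (hSφ : ∀ r, 0 < r → r < δ → ∀ t ∈ S r, 1 - φ t ≤ M * r) : False := by
  have hL : Tendsto Λ atTop atTop := by
    have h0 := hsum.tendsto_atTop_zero
    have h1 : Tendsto (fun k => 1 / Λ k) atTop (nhdsWithin 0 (Set.Ioi 0)) :=
      tendsto_nhdsWithin_iff.2 ⟨h0, Eventually.of_forall fun k => one_div_pos.2 (hpos k)⟩
    have := h1.inv_tendsto_nhdsGT_zero
    refine this.congr fun k => ?_
    simp
  set g : ℕ → ℝ → ℝ := fun n x => √(2 * Λ n + 1) * x ^ (Λ n) with hg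
  have hgs : ∀ n, inSpan Λ (g n) := fun n =>
    ⟨1, fun _ => √(2 * Λ n + 1), fun _ => n, fun x => by simp [hg]⟩
  have hgn : ∀ n, eLpNorm (g n) 2 m01 ≤ 1 := fun n => aux_norm _ (hpos n)
  have hgm : ∀ n, Measurable (fun x => g n (φ x)) := fun n => by
    simp only [hg]; fun_prop
  have hnull : m01 {x | φ x = 1} = 0 := by
    by_contra hne
    have hb : ∀ n, ENNReal.ofReal (Λ n) * m01 {x | φ x = 1} ≤ ENNReal.ofReal C ^ 2 := fun n => by
      have h1 := aux_cheb (fun x => g n (φ x)) m01 (hgm n).aestronglyMeasurable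
        (√(2 * Λ n + 1)) (by positivity) {x | φ x = 1} (fun x hx => by
          simp only [Set.mem_setOf_eq] at hx
          simp [hg, hx])
      have h2 : eLpNorm (fun x => g n (φ x)) 2 m01 ≤ ENNReal.ofReal C :=
        (hbd _ (hgs n)).trans (by simpa using mul_le_mul_right (hgn n) (ENNReal.ofReal C))
      rw [← ENNReal.ofReal_pow (by positivity), Real.sq_sqrt (by linarith [hpos n])] at h1
      refine le_trans ?_ (h1.trans (by gcongr))
      gcongr
      linarith [hpos n]
    have ht : Tendsto (fun n => ENNReal.ofReal (Λ n) * m01 {x | φ x = 1}) atTop (nhds ⊤) := by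
      have := ENNReal.Tendsto.mul_const (b := m01 {x | φ x = 1})
        (ENNReal.tendsto_ofReal_atTop.comp hL) (Or.inl ENNReal.top_ne_zero)
      rwa [ENNReal.top_mul hne] at this
    have := le_of_tendsto' ht hb
    exact absurd this (by simp)
  have hae : ∀ᵐ x ∂m01, φ x ∈ Set.Ico (0:ℝ) 1 := by
    have h1 : ∀ᵐ x ∂m01, φ x ≠ 1 := by
      rw [ae_iff]; simpa using hnull
    have h2 : ∀ᵐ x ∂m01, x ∈ Set.Icc (0:ℝ) 1 := ae_restrict_mem measurableSet_Icc
    filter_upwards [h1, h2] with x h1 h2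
    exact ⟨(hmaps h2).1, lt_of_le_of_ne (hmaps h2).2 h1⟩
  obtain ⟨σ, hσ, hc⟩ := hcpt g hgs hgn
  obtain ⟨ε, hε, hεM⟩ : ∃ ε : ℝ, 0 < ε ∧ ε ^ 2 < 1 / (4 * M) := by
    refine ⟨√(1 / (8 * M)), by positivity, ?_⟩
    rw [Real.sq_sqrt (by positivity)]
    apply one_div_lt_one_div_of_lt <;> linarith
  obtain ⟨N, hN⟩ := hc ε hε
  have hsm : ∀ j ≥ N, eLpNorm (fun x => g (σ j) (φ x)) 2 m01 ≤ ENNReal.ofReal ε := by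
    intro j hj
    have hlim := Lp.eLpNorm_lim_le_liminf_eLpNorm (μ := m01) (p := 2)
      (f := fun j' x => g (σ j) (φ x) - g (σ j') (φ x))
      (fun j' => ((hgm _).sub (hgm _)).aestronglyMeasurable) (fun x => g (σ j) (φ x)) (by
        filter_upwards [hae] with x hx
        have := ((aux_lim _ hx.1 hx.2).comp (hL.comp hσ.tendsto_atTop)).const_sub
          (g (σ j) (φ x))
        rw [sub_zero] at this
        exact this)
    refine hlim.trans ?_
    apply liminf_le_of_frequently_le'
    apply Eventually.frequently
    filter_upwards [eventually_ge_atTop N] with j' hj'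
    exact hN j hj j' hj'
  have hLσ := hL.comp hσ.tendsto_atTop
  obtain ⟨j, hj, hj1, hjδ⟩ := ((eventually_ge_atTop N).and ((hLσ.eventually_ge_atTop 1).and
    (hLσ.eventually_gt_atTop (1 / (2 * M * δ))))).exists
  simp only [Function.comp] at hj1 hjδ
  set l := Λ (σ j) with hl
  have hl0 : 0 < l := hpos _
  set r := 1 / (2 * M * l) with hr
  have hr0 : 0 < r := by positivity
  have hrδ : r < δ := by
    rw [div_lt_iff₀ (by positivity)] at hjδ
    rw [hr, div_lt_iff₀ (by positivity)]
    nlinarith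
  have hMr : l * (M * r) = 1 / 2 := by rw [hr]; field_simp
  have hch := aux_cheb (fun x => g (σ j) (φ x)) m01 (hgm _).aestronglyMeasurable
    (√(2 * l + 1) / 2) (by positivity) (S r) (fun x hx => by
      have h1 := hSφ r hr0 hrδ x hx
      have h2 : M * r ≤ 1 / 2 := by nlinarith [mul_pos hM hr0]
      have h3 := one_add_mul_self_le_rpow_one_add (s := - (M * r)) (by linarith) hj1
      have h4 : (1 + -(M * r)) ^ l ≤ φ x ^ l :=
        Real.rpow_le_rpow (by linarith) (by linarith) hl0.le
      have h5 : 1 / 2 ≤ φ x ^ l := by linarith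
      simp only [hg, ← hl]
      rw [div_eq_mul_one_div]
      gcongr)
  have hmS : m01 (S r) = ENNReal.ofReal r := by
    rw [m01, Measure.restrict_eq_self _ (hSsub r hr0 hrδ), hSv r hr0 hrδ]
  rw [hmS, ← ENNReal.ofReal_pow (by positivity), ← ENNReal.ofReal_mul (by positivity), div_pow,
    Real.sq_sqrt (by linarith)] at hch
  have h6 := hch.trans (pow_le_pow_left' (hsm j hj) 2)
  rw [← ENNReal.ofReal_pow hε.le, ENNReal.ofReal_le_ofReal_iff (by positivity)] at h6
  have h7 : 1 / (4 * M) = 2 * l / 2 ^ 2 * r := by rw [hr]; field_simp; norm_num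
  have h8 : 2 * l / 2 ^ 2 * r ≤ (2 * l + 1) / 2 ^ 2 * r := by gcongr; linarith
  linarith

/-- Let `Λ` be strictly increasing positive with `∑ 1/λ_k < ∞` and
`φ : [0,1] → [0,1]` Borel measurable with `φ(x₀) = 1`. If the composition operator
`C_φ : M²_Λ → L²` is compact (bounded on the span, and every norm-bounded sequence in
the span has a subsequence whose composition with `φ` is Cauchy in `L²`), then
`limsup_{t→x₀⁻} (1−φ(t))/(x₀−t) = +∞` (if `x₀ > 0`) and
`limsup_{t→x₀⁺} (1−φ(t))/(t−x₀) = +∞` (if `x₀ < 1`). -/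
theorem composition_compact_dini
    (Λ : ℕ → ℝ) (hmono : StrictMono Λ) (hpos : ∀ k, 0 < Λ k)
    (hsum : Summable fun k => 1 / Λ k)
    (φ : ℝ → ℝ) (hmeas : Measurable φ)
    (hmaps : Set.MapsTo φ (Set.Icc (0 : ℝ) 1) (Set.Icc (0 : ℝ) 1))
    (x₀ : ℝ) (hx₀ : x₀ ∈ Set.Icc (0 : ℝ) 1) (hφx₀ : φ x₀ = 1)
    (C : ℝ) (hC : 0 < C)
    (hbd : ∀ g : ℝ → ℝ, inSpan Λ g →
      eLpNorm (fun x => g (φ x)) 2 m01 ≤ ENNReal.ofReal C * eLpNorm g 2 m01)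
    (hcpt : ∀ g : ℕ → ℝ → ℝ, (∀ n, inSpan Λ (g n)) →
      (∀ n, eLpNorm (g n) 2 m01 ≤ 1) →
      ∃ σ : ℕ → ℕ, StrictMono σ ∧
        ∀ ε : ℝ, 0 < ε → ∃ N : ℕ, ∀ j ≥ N, ∀ j' ≥ N,
          eLpNorm (fun x => g (σ j) (φ x) - g (σ j') (φ x)) 2 m01 ≤
            ENNReal.ofReal ε) :
    (0 < x₀ → ∀ M : ℝ,
      ∃ᶠ t in nhdsWithin x₀ (Set.Ico 0 x₀), M ≤ (1 - φ t) / (x₀ - t)) ∧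
    (x₀ < 1 → ∀ M : ℝ,
      ∃ᶠ t in nhdsWithin x₀ (Set.Ioc x₀ 1), M ≤ (1 - φ t) / (t - x₀)) := by
  constructor
  · intro hx M
    by_contra hcon
    rw [not_frequently, eventually_nhdsWithin_iff, Metric.eventually_nhds_iff] at hcon
    obtain ⟨δ, hδ, h⟩ := hcon
    refine aux_key Λ hpos hsum φ hmeas hmaps C hbd hcpt (max M 1) (min δ x₀)
      (by positivity) (by positivity) (fun r => Set.Ioo (x₀ - r) x₀) ?_ ?_ ?_
    · intro r hr0 hr t ht
      have := lt_min_iff.1 hr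
      exact ⟨by linarith [ht.1], by linarith [ht.2, hx₀.2]⟩
    · intro r hr0 hr
      simp
    · intro r hr0 hr t ht
      have hr' := lt_min_iff.1 hr
      have ht1 := ht.1
      have ht2 := ht.2
      have h1 := h (y := t) (by
        rw [Real.dist_eq, abs_lt]; constructor <;> linarith) ⟨by linarith, ht.2⟩
      rw [not_le, div_lt_iff₀ (by linarith)] at h1
      have h2 : M * (x₀ - t) ≤ max M 1 * (x₀ - t) :=
        mul_le_mul_of_nonneg_right (le_max_left _ _) (by linarith)
      have h3 : max M 1 * (x₀ - t) ≤ max M 1 * r :=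
        mul_le_mul_of_nonneg_left (by linarith) (by positivity)
      linarith
  · intro hx M
    by_contra hcon
    rw [not_frequently, eventually_nhdsWithin_iff, Metric.eventually_nhds_iff] at hcon
    obtain ⟨δ, hδ, h⟩ := hcon
    have hx' : 0 < 1 - x₀ := by linarith
    refine aux_key Λ hpos hsum φ hmeas hmaps C hbd hcpt (max M 1) (min δ (1 - x₀))
      (by positivity) (by positivity) (fun r => Set.Ioo x₀ (x₀ + r)) ?_ ?_ ?_
    · intro r hr0 hr t ht
      have := lt_min_iff.1 hr
      exact ⟨by linarith [ht.1, hx₀.1], by linarith [ht.2, hx₀.2]⟩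
    · intro r hr0 hr
      simp
    · intro r hr0 hr t ht
      have hr' := lt_min_iff.1 hr
      have ht1 := ht.1
      have ht2 := ht.2
      have h1 := h (y := t) (by
        rw [Real.dist_eq, abs_lt]; constructor <;> linarith) ⟨ht.1, by linarith⟩
      rw [not_le, div_lt_iff₀ (by linarith)] at h1
      have h2 : M * (t - x₀) ≤ max M 1 * (t - x₀) :=
        mul_le_mul_of_nonneg_right (le_max_left _ _) (by linarith)
      have h3 : max M 1 * (t - x₀) ≤ max M 1 * r :=
        mul_le_mul_of_nonneg_left (by linarith) (by positivity)
      linarith
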